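/- arXiv:2303.04886 — 2 statements merged into one kernel-verified Lean document; each statement's English description precedes it below -/
import Mathlib

section
/- The set of all ratios o(G)/o(H), where G ranges over all finite nilpotent groups and H ranges over all subgroups of G, is dense in the interval [0, ∞). That is, for every real number a ≥ 0 and every ε > 0, there exist a finite nilpotent group G and a subgroup H of G such that |o(G)/o(H) - a| < ε. -/
open Filter Topology

/-- The average order of the elements of a finite group `G`:
`o(G) = (1/|G|) * ∑_{x ∈ G} |x|`. -/
noncomputable def avgOrder (G : Type*) [Group G] : ℝ :=
  (∑ᶠ x : G, (orderOf x : ℝ)) / (Nat.card G)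

set_option linter.style.haveILetI false

theorem avgOrder_eq_sum (G : Type*) [Group G] [Fintype G] :
    avgOrder G = (∑ x : G, (orderOf x : ℝ)) / (Nat.card G) := by
  unfold avgOrder
  rw [finsum_eq_sum_of_fintype]

theorem avgOrder_pos (G : Type*) [Group G] [Finite G] : 0 < avgOrder G := by
  haveI := Fintype.ofFinite G
  rw [avgOrder_eq_sum]
  apply div_pos
  · apply Finset.sum_pos
    · intro x _
      exact_mod_cast orderOf_pos x
    · exact ⟨1, Finset.mem_univ _⟩
  · exact_mod_cast Nat.card_pos

theorem avgOrder_congr {G K : Type*} [Group G] [Group K] [Finite G] (e : G ≃* K) :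
    avgOrder G = avgOrder K := by
  haveI := Fintype.ofFinite G
  haveI := Fintype.ofEquiv G e.toEquiv
  rw [avgOrder_eq_sum, avgOrder_eq_sum, Nat.card_congr e.toEquiv]
  congr 1
  apply Fintype.sum_equiv e.toEquiv
  intro x
  simp

theorem avgOrder_prod {G K : Type*} [Group G] [Group K] [Finite G] [Finite K]
    (h : (Nat.card G).Coprime (Nat.card K)) :
    avgOrder (G × K) = avgOrder G * avgOrder K := by
  haveI := Fintype.ofFinite G
  haveI := Fintype.ofFinite K
  rw [avgOrder_eq_sum, avgOrder_eq_sum, avgOrder_eq_sum, Nat.card_prod, div_mul_div_comm,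
    Finset.sum_mul_sum, Fintype.sum_prod_type]
  push_cast
  congr 1
  refine Finset.sum_congr rfl fun x _ => Finset.sum_congr rfl fun y _ => ?_
  rw [Prod.orderOf, Nat.Coprime.lcm_eq_mul]
  · push_cast; rfl
  · exact Nat.Coprime.of_dvd (orderOf_dvd_natCard x) (orderOf_dvd_natCard y) h

theorem avgOrder_exp_prime {G : Type*} [Group G] [Finite G] (p : ℕ)
    (h : ∀ x : G, x ≠ 1 → orderOf x = p) :
    avgOrder G = (1 + ((Nat.card G : ℝ) - 1) * p) / Nat.card G := by
  classical
  haveI := Fintype.ofFinite G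
  rw [avgOrder_eq_sum]
  congr 1
  rw [← Finset.add_sum_erase _ _ (Finset.mem_univ (1 : G)), orderOf_one]
  rw [Finset.sum_congr rfl (g := fun _ => (p : ℝ))]
  · rw [Finset.sum_const, Finset.card_erase_of_mem (Finset.mem_univ _), Finset.card_univ,
      Nat.card_eq_fintype_card, nsmul_eq_mul, Nat.cast_sub Fintype.card_pos]
    simp
  · intro x hx
    rw [h x (Finset.ne_of_mem_erase hx)]

/-- ratio `r` is realized by a finite nilpotent group whose order is coprime to primes `≥ n` -/
def Realized (n : ℕ) (r : ℝ) : Prop :=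
  ∃ (G : Type) (_ : Group G), Finite G ∧ Group.IsNilpotent G ∧
    (∀ q : ℕ, q.Prime → n ≤ q → (Nat.card G).Coprime q) ∧
      ∃ H : Subgroup G, avgOrder G / avgOrder H = r

theorem Realized.mono {n m : ℕ} {r : ℝ} (h : Realized n r) (hnm : n ≤ m) : Realized m r := by
  obtain ⟨G, i, h1, h2, h3, h4⟩ := h
  exact ⟨G, i, h1, h2, fun q hq hm => h3 q hq (hnm.trans hm), h4⟩

noncomputable def fac (n : ℕ) : ℝ :=
  if n.Prime then ((n : ℝ) ^ 3 - n + 1) / (n * ((n : ℝ) ^ 2 - n + 1)) else 1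

theorem fac_lower (n : ℕ) :
    1 + (1 / 4) * Set.indicator {p : ℕ | p.Prime} (fun n : ℕ => (1 : ℝ) / n) n ≤ fac n := by
  unfold fac
  by_cases h : n.Prime
  · have h2 : (2 : ℝ) ≤ n := by exact_mod_cast h.two_le
    have hd : 0 < (n : ℝ) ^ 2 - n + 1 := by nlinarith
    rw [Set.indicator_of_mem (by exact h), if_pos h, le_div_iff₀ (by positivity)]
    have : (1 + 1 / 4 * (1 / (n : ℝ))) * (n * ((n : ℝ) ^ 2 - n + 1))
      = (n + 1 / 4) * ((n : ℝ) ^ 2 - n + 1) := by field_simp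
    rw [this]
    nlinarith
  · rw [Set.indicator_of_notMem (by exact h), if_neg h]; simp

theorem fac_upper (n : ℕ) (hn : 0 < n) : fac n ≤ 1 + 1 / n := by
  unfold fac
  have hn' : (1 : ℝ) ≤ n := by exact_mod_cast hn
  split_ifs with h
  · have hd : 0 < (n : ℝ) ^ 2 - n + 1 := by nlinarith
    rw [div_le_iff₀ (by positivity)]
    have : (1 + 1 / (n : ℝ)) * (n * ((n : ℝ) ^ 2 - n + 1))
      = (n + 1) * ((n : ℝ) ^ 2 - n + 1) := by field_simp
    rw [this]
    nlinarith
  · have : 0 ≤ 1 / (n : ℝ) := by positivity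
    linarith

theorem Realized.step {n : ℕ} {r : ℝ} (h : Realized n r) : Realized (n + 1) (r * fac n) := by
  by_cases hp : n.Prime
  swap
  · unfold fac; rw [if_neg hp, mul_one]; exact h.mono (Nat.le_succ n)
  obtain ⟨G, i, h1, h2, h3, H, h4⟩ := h
  haveI : Fact n.Prime := ⟨hp⟩
  let C := Multiplicative (ZMod n)
  let K := C × C
  haveI : Finite C := inferInstanceAs (Finite (ZMod n))
  have hC : Nat.card C = n := by
    change Nat.card (ZMod n) = n
    simp
  have hexpC : ∀ x : C, x ^ n = 1 := fun x => by
    have := pow_card_eq_one' (x := x)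
    rwa [hC] at this
  have hK : Nat.card K = n ^ 2 := by rw [Nat.card_prod, hC, sq]
  have hexpK : ∀ x : K, x ^ n = 1 := fun x => Prod.ext (hexpC _) (hexpC _)
  have oC := avgOrder_exp_prime (G := C) n fun x hx => orderOf_eq_prime (hexpC x) hx
  have oK := avgOrder_exp_prime (G := K) n fun x hx => orderOf_eq_prime (hexpK x) hx
  let L : Subgroup K := (MonoidHom.inl C C).range
  have hinj : Function.Injective (MonoidHom.inl C C) := fun x y h => by simpa using h
  have oL : avgOrder L = avgOrder C := (avgOrder_congr (MonoidHom.ofInjective hinj)).symm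
  have hcop : (Nat.card G).Coprime (Nat.card K) := by
    rw [hK]; exact (h3 n hp le_rfl).pow_right 2
  refine ⟨G × K, inferInstance, inferInstance, inferInstance, ?_, H.prod L, ?_⟩
  · intro q hq hnq
    rw [Nat.card_prod, hK]
    refine Nat.Coprime.mul_left (h3 q hq (by omega)) (Nat.Coprime.pow_left _ ?_)
    exact (Nat.coprime_primes hp hq).2 (by omega)
  · rw [avgOrder_prod hcop, avgOrder_congr (Subgroup.prodEquiv H L), avgOrder_prod (G := H) (K := L), oL, ← h4,
      mul_div_mul_comm]
    · congr 1
      rw [oC, oK, hC, hK]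
      unfold fac
      rw [if_pos hp]
      have h2 : (2 : ℝ) ≤ n := by exact_mod_cast hp.two_le
      have hd : 0 < (n : ℝ) ^ 2 - n + 1 := by nlinarith
      have hd' : 0 < 1 + ((n : ℝ) - 1) * n := by nlinarith
      push_cast
      field_simp
      ring
    · exact Nat.Coprime.of_dvd (Subgroup.card_subgroup_dvd_card H)
        (Subgroup.card_subgroup_dvd_card L) hcop

theorem Realized.prod {N : ℕ} {r : ℝ} (h : Realized N r) (k : ℕ) :
    Realized (N + k) (r * ∏ j ∈ Finset.range k, fac (N + j)) := by
  induction k with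
  | zero => simpa using h
  | succ k ih => rw [Finset.prod_range_succ, ← mul_assoc]; exact ih.step

theorem prod_fac_unbounded (N : ℕ) (B : ℝ) : ∃ k, B < ∏ j ∈ Finset.range k, fac (N + j) := by
  set g := Set.indicator {p : ℕ | p.Prime} (fun n : ℕ => (1 : ℝ) / n) with hg
  have hg0 : ∀ n, 0 ≤ g n := fun n => Set.indicator_nonneg (fun _ _ => by positivity) n
  have h1 : ¬ Summable (fun j => g (j + N)) := by
    rw [summable_nat_add_iff]
    exact not_summable_one_div_on_primes
  rw [not_summable_iff_tendsto_nat_atTop_of_nonneg (fun j => hg0 _)] at h1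
  obtain ⟨k, hk⟩ := (h1.eventually_gt_atTop (4 * B)).exists
  refine ⟨k, ?_⟩
  have key : ∀ k, 1 + (1 / 4) * ∑ j ∈ Finset.range k, g (j + N) ≤
      ∏ j ∈ Finset.range k, fac (N + j) := by
    intro k
    induction k with
    | zero => simp
    | succ k ih =>
      rw [Finset.sum_range_succ, Finset.prod_range_succ]
      have := fac_lower (N + k)
      have e : g (k + N) = g (N + k) := by rw [add_comm]
      rw [e]
      have hs : 0 ≤ ∑ j ∈ Finset.range k, g (j + N) := Finset.sum_nonneg fun _ _ => hg0 _
      have h3 := mul_le_mul ih this (by have := hg0 (N + k); rw [← hg]; positivity)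
        (by linarith)
      rw [← hg] at h3
      nlinarith [mul_nonneg hs (hg0 (N + k))]
  linarith [key k]

theorem exists_close {a ε r : ℝ} {N : ℕ} (hr : 0 < r) (ha : r < a) (hε : 0 < ε)
    (h : Realized N r) : ∃ m s, Realized m s ∧ |s - a| < ε := by
  have ha0 : 0 < a := hr.trans ha
  obtain ⟨M0, hM0⟩ := exists_nat_gt (a / ε)
  set M := max (max M0 N) 1 with hM
  have hMpos : 0 < M := by omega
  have hMr : (M0 : ℝ) ≤ M := by exact_mod_cast (by omega : M0 ≤ M)
  have hMN := h.mono (show N ≤ M by omega)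
  have hex : ∃ k, a < r * ∏ j ∈ Finset.range k, fac (M + j) := by
    obtain ⟨k, hk⟩ := prod_fac_unbounded M (a / r)
    exact ⟨k, by rwa [div_lt_iff₀' hr] at hk⟩
  classical
  obtain ⟨k, hk, hmin⟩ := Nat.findX hex
  refine ⟨_, _, hMN.prod k, ?_⟩
  rw [abs_lt]
  refine ⟨by linarith, ?_⟩
  cases k with
  | zero => simp at hk; linarith
  | succ k =>
    have h1 := not_lt.1 (hmin k (Nat.lt_succ_self k))
    rw [Finset.prod_range_succ, ← mul_assoc] at hk ⊢
    have h2 := fac_upper (M + k) (by omega)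
    have h0 : (0 : ℝ) ≤ fac (M + k) := by
      refine le_trans ?_ (fac_lower _)
      have : 0 ≤ Set.indicator {p : ℕ | p.Prime} (fun n : ℕ => (1 : ℝ) / n) (M + k) :=
        Set.indicator_nonneg (fun _ _ => by positivity) _
      positivity
    have hMk : a / ε < ((M + k : ℕ) : ℝ) := by
      push_cast; linarith [(Nat.cast_nonneg k : (0 : ℝ) ≤ k)]
    have h3 : a * (1 / ((M + k : ℕ) : ℝ)) < ε := by
      rw [div_lt_iff₀ hε] at hMk
      rw [mul_one_div, div_lt_iff₀]
      · linarith
      · exact_mod_cast (by omega : 0 < M + k)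
    have h4 := mul_le_mul h1 h2 h0 ha0.le
    linarith

/-! The group with small ratio. -/

@[ext] structure Wr (p : ℕ) where
  v : ZMod p → ZMod (p ^ 2)
  t : ZMod p

namespace Wr

variable {p : ℕ}

instance : Group (Wr p) :=
  { mul := fun x y => ⟨fun i => x.v i + y.v (i + x.t), x.t + y.t⟩
    one := ⟨fun _ => 0, 0⟩
    inv := fun x => ⟨fun i => - x.v (i - x.t), - x.t⟩
    mul_assoc := by
      intro x y z
      refine Wr.ext (funext fun i => ?_) (add_assoc _ _ _)
      change x.v i + y.v (i + x.t) + z.v (i + (x.t + y.t)) =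
        x.v i + (y.v (i + x.t) + z.v (i + x.t + y.t))
      rw [add_assoc, add_assoc i]
    one_mul := by
      intro x
      refine Wr.ext (funext fun i => ?_) (zero_add _)
      change 0 + x.v (i + 0) = x.v i
      simp
    mul_one := by
      intro x
      refine Wr.ext (funext fun i => ?_) (add_zero _)
      change x.v i + 0 = x.v i
      simp
    inv_mul_cancel := by
      intro x
      refine Wr.ext (funext fun i => ?_) (neg_add_cancel _)
      change - x.v (i - x.t) + x.v (i + - x.t) = 0
      rw [← sub_eq_add_neg]; simp }

theorem mul_v (x y : Wr p) (i : ZMod p) : (x * y).v i = x.v i + y.v (i + x.t) := rfl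
theorem mul_t (x y : Wr p) : (x * y).t = x.t + y.t := rfl
theorem one_v (i : ZMod p) : (1 : Wr p).v i = 0 := rfl
theorem one_t : (1 : Wr p).t = 0 := rfl
theorem inv_v (x : Wr p) (i : ZMod p) : (x⁻¹).v i = - x.v (i - x.t) := rfl
theorem inv_t (x : Wr p) : (x⁻¹).t = - x.t := rfl

theorem pow_t (x : Wr p) (k : ℕ) : (x ^ k).t = k * x.t := by
  induction k with
  | zero => simp [one_t]
  | succ k ih => rw [pow_succ, mul_t, ih]; push_cast; ring

theorem pow_v (x : Wr p) (k : ℕ) (i : ZMod p) :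
    (x ^ k).v i = ∑ j ∈ Finset.range k, x.v (i + j * x.t) := by
  induction k with
  | zero => simp [one_v]
  | succ k ih => rw [pow_succ x k, mul_v, ih, Finset.sum_range_succ, pow_t]

variable [Fact p.Prime]

instance : Finite (Wr p) := by
  haveI : NeZero (p ^ 2) := ⟨pow_ne_zero _ (NeZero.ne p)⟩
  apply Finite.of_injective (fun x : Wr p => (x.v, x.t))
  intro x y h
  simp only [Prod.mk.injEq] at h
  exact Wr.ext h.1 h.2

/-- The sum-zero subgroup. -/
def S (p : ℕ) [Fact p.Prime] : Subgroup (Wr p) where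
  carrier := {x | ∑ i, x.v i = 0}
  one_mem' := by simp [one_v]
  mul_mem' := by
    intro x y hx hy
    simp only [Set.mem_ofPred_eq, mul_v, Finset.sum_add_distrib] at *
    rw [hx, zero_add, ← hy]
    exact Fintype.sum_equiv (Equiv.addRight x.t) _ _ fun _ => rfl
  inv_mem' := by
    intro x hx
    simp only [Set.mem_ofPred_eq, inv_v, Finset.sum_neg_distrib, neg_eq_zero] at *
    rw [← hx]
    exact Fintype.sum_equiv (Equiv.subRight x.t) _ _ fun _ => rfl

/-- Projection to the shift. -/
def pr (p : ℕ) [Fact p.Prime] : S p →* Multiplicative (ZMod p) where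
  toFun x := Multiplicative.ofAdd x.1.t
  map_one' := rfl
  map_mul' _ _ := rfl

theorem mem_ker (x : S p) : x ∈ (pr p).ker ↔ x.1.t = 0 := Iff.rfl

theorem pow_eq_one_of_t_ne (x : S p) (hx : x.1.t ≠ 0) : x ^ p = 1 := by
  apply Subtype.ext
  rw [Subgroup.coe_pow]
  refine Wr.ext (funext fun i => ?_) ?_
  · rw [pow_v]
    change _ = 0
    have hs : ∑ i, x.1.v i = 0 := x.2
    rw [← hs]
    refine Finset.sum_bij' (fun j _ => i + (j : ZMod p) * x.1.t)
      (fun k _ => ((k - i) / x.1.t).val) ?_ ?_ ?_ ?_ ?_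
    · intros; exact Finset.mem_univ _
    · intro k _; exact Finset.mem_range.2 (ZMod.val_lt _)
    · intro j hj
      simp only [add_sub_cancel_left]
      rw [mul_div_cancel_right₀ _ hx, ZMod.val_cast_of_lt (Finset.mem_range.1 hj)]
    · intro k _
      simp only [ZMod.natCast_zmod_val]
      rw [div_mul_cancel₀ _ hx]; ring
    · intros; rfl
  · rw [pow_t]; simp [one_t]

theorem pow_v_of_t_eq (x : S p) (hx : x.1.t = 0) (k : ℕ) (i : ZMod p) :
    (x ^ k).1.v i = k * x.1.v i := by
  rw [Subgroup.coe_pow, pow_v, hx]; simp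

theorem pow_sq_eq_one_of_t_eq (x : S p) (hx : x.1.t = 0) : x ^ (p ^ 2) = 1 := by
  apply Subtype.ext
  refine Wr.ext (funext fun i => ?_) ?_
  · rw [pow_v_of_t_eq x hx, ZMod.natCast_self, zero_mul]; rfl
  · rw [Subgroup.coe_pow, pow_t, hx, mul_zero]; rfl

theorem pow_sq_eq_one (x : S p) : x ^ (p ^ 2) = 1 := by
  by_cases hx : x.1.t = 0
  · exact pow_sq_eq_one_of_t_eq x hx
  · rw [sq, pow_mul, pow_eq_one_of_t_ne x hx, one_pow]

theorem isPGroup : IsPGroup p (S p) := fun x => ⟨2, pow_sq_eq_one x⟩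

/-- An element of order `p ^ 2`. -/
def e (p : ℕ) [Fact p.Prime] : S p :=
  ⟨⟨Pi.single 0 1 - Pi.single 1 1, 0⟩, by
    change ∑ i, (Pi.single 0 1 - Pi.single 1 1 : ZMod p → ZMod (p ^ 2)) i = 0
    simp [Finset.sum_sub_distrib]⟩

theorem e_pow : (e p) ^ p ≠ 1 := by
  intro h
  have h1 := congrArg (fun y : S p => y.1.v 0) h
  simp only [pow_v_of_t_eq (e p) rfl] at h1
  change (p : ZMod (p ^ 2)) * (Pi.single 0 1 - Pi.single 1 1 : ZMod p → ZMod (p ^ 2)) 0 = 0 at h1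
  have hp : p.Prime := Fact.out
  simp only [Pi.sub_apply, Pi.single_eq_same, Pi.single_eq_of_ne (zero_ne_one' (ZMod p)),
    sub_zero, mul_one] at h1
  rw [ZMod.natCast_eq_zero_iff] at h1
  have := Nat.le_of_dvd hp.pos h1
  nlinarith [hp.two_le]

theorem order_pair (x : (pr p).ker) (y : (pr p).ker) (hy : y.1 = e p) :
    p ^ 2 ≤ orderOf x + orderOf (x * y) := by
  have hp : p.Prime := Fact.out
  have key : ∀ z : (pr p).ker, orderOf z = p ^ 2 ∨ z ^ p = 1 := by
    intro z
    have h1 : orderOf z ∣ p ^ 2 := orderOf_dvd_of_pow_eq_one (Subtype.ext (pow_sq_eq_one z.1))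
    obtain ⟨k, hk, hk'⟩ := (Nat.dvd_prime_pow hp).1 h1
    by_cases h2 : k = 2
    · left; rw [hk', h2]
    · right
      apply orderOf_dvd_iff_pow_eq_one.1
      rw [hk']
      have hk1 : k ≤ 1 := by omega
      simpa using pow_dvd_pow p hk1
  rcases key x with h | h
  · omega
  rcases key (x * y) with h' | h'
  · omega
  exfalso
  apply e_pow (p := p)
  have hc : Commute x y := by
    apply Subtype.ext; apply Subtype.ext
    refine Wr.ext (funext fun i => ?_) (add_comm _ _)
    change x.1.1.v i + y.1.1.v (i + x.1.1.t) = y.1.1.v i + x.1.1.v (i + y.1.1.t)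
    rw [(mem_ker _).1 x.2, (mem_ker _).1 y.2, add_zero, add_comm]
  rw [hc.mul_pow, h, one_mul] at h'
  rw [← hy]
  exact congrArg Subtype.val h'

theorem ratio_le : avgOrder (S p) / avgOrder (pr p).ker ≤ 3 / p := by
  classical
  have hp : p.Prime := Fact.out
  have hp0 : (0 : ℝ) < p := by exact_mod_cast hp.pos
  haveI := Fintype.ofFinite (S p)
  haveI := Fintype.ofFinite (pr p).ker
  have hsurj : Function.Surjective (pr p) := by
    intro t
    refine ⟨⟨⟨0, t.toAdd⟩, ?_⟩, rfl⟩
    change ∑ i, (0 : ZMod p → ZMod (p ^ 2)) i = 0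
    simp
  have hidx : (pr p).ker.index = p := by
    rw [Subgroup.index_ker, MonoidHom.range_eq_top.2 hsurj]
    simp
  have hcard : Nat.card (S p) = Nat.card (pr p).ker * p := by
    rw [← Subgroup.card_mul_index (pr p).ker, hidx]
  set h : ℝ := ((Nat.card (pr p).ker : ℕ) : ℝ) with hh
  have hh0 : 0 < h := by rw [hh]; exact_mod_cast Nat.card_pos
  set T : ℝ := ∑ x : (pr p).ker, (orderOf x : ℝ) with hT
  have hT1 : p ^ 2 * h ≤ 2 * T := by
    let y : (pr p).ker := ⟨e p, rfl⟩
    have e1 : T = ∑ x : (pr p).ker, (orderOf (x * y) : ℝ) :=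
      (Fintype.sum_equiv (Equiv.mulRight y) _ _ fun _ => rfl).symm
    have e2 : 2 * T = ∑ x : (pr p).ker, ((orderOf x : ℝ) + orderOf (x * y)) := by
      rw [Finset.sum_add_distrib, ← e1, two_mul]
    rw [e2]
    have := Finset.card_nsmul_le_sum Finset.univ
      (fun x : (pr p).ker => ((orderOf x : ℝ) + orderOf (x * y))) ((p : ℝ) ^ 2)
      (fun x _ => by exact_mod_cast order_pair x y rfl)
    rw [nsmul_eq_mul, Finset.card_univ, ← Nat.card_eq_fintype_card] at this
    linarith
  have hsum : ∑ x : S p, (orderOf x : ℝ) ≤ T + p * (h * p) := by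
    have hb : ∀ x : S p, (orderOf x : ℝ) ≤ (if x ∈ (pr p).ker then (orderOf x : ℝ) else 0) + p := by
      intro x
      split_ifs with hx
      · linarith
      · rw [zero_add]
        exact_mod_cast orderOf_le_of_pow_eq_one hp.pos (pow_eq_one_of_t_ne x hx)
    refine (Finset.sum_le_sum fun x _ => hb x).trans ?_
    rw [Finset.sum_add_distrib, ← Finset.sum_filter]
    apply add_le_add
    · rw [hT]
      apply le_of_eq
      rw [Finset.sum_subtype (p := fun x => x ∈ (pr p).ker) _ (by simp)]
      refine Fintype.sum_equiv (Equiv.refl _) _ _ fun x => ?_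
      simp
      rfl
    · rw [Finset.sum_const, nsmul_eq_mul, Finset.card_univ, ← Nat.card_eq_fintype_card, hcard]
      push_cast
      rw [← hh]
      linarith
  have hT0 : 0 < T := by
    have : 0 < p ^ 2 * h := by positivity
    linarith
  rw [avgOrder_eq_sum, avgOrder_eq_sum, hcard, ← hT]
  push_cast
  rw [← hh, div_div_eq_mul_div, div_mul_eq_mul_div, div_div, div_le_div_iff₀ (by positivity) hp0]
  nlinarith [mul_le_mul_of_nonneg_left hsum (mul_pos hh0 hp0).le,
    mul_le_mul_of_nonneg_left hT1 (mul_pos hh0 hp0).le]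

theorem realized : Realized (p + 1) (avgOrder (S p) / avgOrder (pr p).ker) := by
  have hp : p.Prime := Fact.out
  refine ⟨S p, inferInstance, inferInstance, isPGroup.isNilpotent, ?_, (pr p).ker, rfl⟩
  intro q hq hpq
  obtain ⟨n, hn⟩ := IsPGroup.iff_card.1 (isPGroup (p := p))
  rw [hn]
  exact Nat.Coprime.pow_left _ ((Nat.coprime_primes hp hq).2 (by omega))

end Wr

theorem avgOrder_dense_pos (a ε : ℝ) (ha : 0 < a) (hε : 0 < ε) :
    ∃ m s, Realized m s ∧ |s - a| < ε := by
  obtain ⟨M, hM⟩ := exists_nat_gt (3 / a)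
  obtain ⟨p, hpM, hp⟩ := Nat.exists_infinite_primes M
  haveI : Fact p.Prime := ⟨hp⟩
  refine exists_close (r := avgOrder (Wr.S p) / avgOrder (Wr.pr p).ker) ?_ ?_ hε Wr.realized
  · exact div_pos (avgOrder_pos _) (avgOrder_pos _)
  · refine Wr.ratio_le.trans_lt ?_
    have hpM' : (M : ℝ) ≤ p := by exact_mod_cast hpM
    have hp0 : (0 : ℝ) < p := by exact_mod_cast hp.pos
    rw [div_lt_iff₀ ha] at hM
    rw [div_lt_iff₀ hp0]
    nlinarith

/-- The set of ratios `o(G)/o(H)`, with `G` finite nilpotent and `H ≤ G`,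
is dense in `[0, ∞)`. -/
theorem avgOrder_ratio_nilpotent_dense :
    ∀ a : ℝ, 0 ≤ a → ∀ ε : ℝ, 0 < ε →
      ∃ (G : Type) (_ : Group G), Finite G ∧ Group.IsNilpotent G ∧
        ∃ H : Subgroup G, |avgOrder G / avgOrder H - a| < ε := by
  intro a ha ε hε
  obtain ⟨m, s, ⟨G, i, h1, h2, -, H, h4⟩, hs⟩ :=
    avgOrder_dense_pos (a + ε / 2) (ε / 2) (by linarith) (by linarith)
  refine ⟨G, i, h1, h2, H, ?_⟩
  rw [h4]
  rw [abs_lt] at hs ⊢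
  constructor <;> linarith
end

section
/- Let G be a finite group and let K be a normal subgroup of G. Then ψ(G) ≥ |K| · ψ(G/K), where the quotient group G/K has sum of element orders ψ(G/K) = ∑_{y ∈ G/K} |y|. Equivalently, ∑_{x ∈ G} |x| ≥ ∑_{x ∈ G} |xK|, since the order of the coset xK in G/K divides the order of x in G. -/
open Filter Topology

/-- The sum of element orders of a finite group `G`: `ψ(G) = ∑_{x ∈ G} |x|`. -/
noncomputable def sumOrders (G : Type*) [Group G] : ℕ :=
  ∑ᶠ x : G, orderOf x

/-- For a finite group `G` and a normal subgroup `K` of `G`,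
`ψ(G) ≥ |K| ⬝ ψ(G/K)`. -/
theorem card_mul_sumOrders_quotient_le (G : Type*) [Group G] [Finite G]
    (K : Subgroup G) [K.Normal] :
    Nat.card K * sumOrders (G ⧸ K) ≤ sumOrders G := by
  classical
  have := Fintype.ofFinite G
  have := Fintype.ofFinite K
  have := Fintype.ofFinite (G ⧸ K)
  unfold sumOrders
  rw [finsum_eq_sum_of_fintype, finsum_eq_sum_of_fintype, Nat.card_eq_fintype_card]
  let f : (G ⧸ K) × K → G := fun p => p.1.out * p.2
  have hq : ∀ p, (QuotientGroup.mk (f p) : G ⧸ K) = p.1 := by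
    intro p
    simp [f]
  have hf : Function.Injective f := by
    intro p q h
    have h1 : p.1 = q.1 := by rw [← hq p, ← hq q, h]
    refine Prod.ext h1 (Subtype.ext ?_)
    simp only [f, h1] at h
    exact mul_left_cancel h
  calc Fintype.card K * ∑ y : G ⧸ K, orderOf y
      = ∑ p : (G ⧸ K) × K, orderOf p.1 := by
        rw [Fintype.sum_prod_type]
        simp [Finset.mul_sum]
    _ ≤ ∑ p : (G ⧸ K) × K, orderOf (f p) := by
        refine Finset.sum_le_sum fun p _ => ?_
        refine Nat.le_of_dvd (orderOf_pos _) ?_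
        have := orderOf_map_dvd (QuotientGroup.mk' K) (f p)
        rwa [QuotientGroup.mk'_apply, hq p] at this
    _ = ∑ x ∈ Finset.univ.image f, orderOf x := by
        rw [Finset.sum_image fun a _ b _ h => hf h]
    _ ≤ ∑ x : G, orderOf x := Finset.sum_le_sum_of_subset (Finset.subset_univ _)
end
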